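/- The ℚ-subspace 𝓘 of ΣD_n spanned by the basis elements {B_q : q ∈ C_1 ∪ C_n ∪ C_n'} is a two-sided ideal of the descent algebra ΣD_n. -/

import Mathlib

open scoped Classical

namespace DescentD

/-- The domain on which the Coxeter group `D_n` acts: the pair `(k, b)` encodes the
integer `k + 1` if `b = true` and `-(k + 1)` if `b = false`.  (We use `Fin (n + 1)`
so that the type is always nonempty; only the points with `k < n` are moved.) -/
abbrev Dom (n : ℕ) := Fin (n + 1) × Bool

/-- The point of `Dom n` encoding the nonzero integer `a` (for `1 ≤ |a| ≤ n`). -/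
def pt (n : ℕ) (a : ℤ) : Dom n :=
  (⟨(a.natAbs - 1) % (n + 1), Nat.mod_lt _ n.succ_pos⟩, decide (0 < a))

/-- The transposition exchanging the points encoding `a` and `b`. -/
def swapD (n : ℕ) (a b : ℤ) : Equiv.Perm (Dom n) := Equiv.swap (pt n a) (pt n b)

/-- The Coxeter generators of `D_n`:  index `0` is `s_{1'} = (-2,1)(-1,2)` and index
`i` with `1 ≤ i ≤ n - 1` is `s_i = (-i-1,-i)(i,i+1)`. -/
def gen (n : ℕ) (i : ℕ) : Equiv.Perm (Dom n) :=
  if i = 0 then swapD n (-2) 1 * swapD n (-1) 2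
  else swapD n (-(i : ℤ) - 1) (-(i : ℤ)) * swapD n (i : ℤ) ((i : ℤ) + 1)

/-- The Coxeter group `D_n`, as the subgroup generated by `s_{1'}, s_1, …, s_{n-1}`. -/
def Dgroup (n : ℕ) : Subgroup (Equiv.Perm (Dom n)) :=
  Subgroup.closure (gen n '' Set.Iio n)

/-- Coxeter length of `w` with respect to the generators of `D_n`. -/
noncomputable def len (n : ℕ) (w : Equiv.Perm (Dom n)) : ℕ :=
  sInf {k | ∃ l : List ℕ, (∀ i ∈ l, i < n) ∧ l.length = k ∧ (l.map (gen n)).prod = w}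

/-- The parabolic subgroup `W_J` for a set `J` of generator indices. -/
def WJ (n : ℕ) (J : Set ℕ) : Subgroup (Equiv.Perm (Dom n)) :=
  Subgroup.closure (gen n '' J)

/-- The set `X_J` of minimal length left coset representatives of `W_J` in `D_n`. -/
def X (n : ℕ) (J : Set ℕ) : Set (Equiv.Perm (Dom n)) :=
  {w | w ∈ Dgroup n ∧ ∀ u ∈ WJ n J, len n w ≤ len n (w * u)}

/-- `𝒳_J`: the sum, in the group algebra `ℚ[D_n]`, of the minimal length left coset
representatives of `W_J`. -/
noncomputable def XX (n : ℕ) (J : Set ℕ) : MonoidAlgebra ℚ (Equiv.Perm (Dom n)) :=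
  ∑ w : Equiv.Perm (Dom n),
    if w ∈ X n J then MonoidAlgebra.of ℚ (Equiv.Perm (Dom n)) w else 0

/-- `q` is a composition of `m`: a list of positive integers with sum `m`. -/
def IsComposition (q : List ℕ) (m : ℕ) : Prop := (∀ x ∈ q, 0 < x) ∧ q.sum = m

/-- The four families making up `C(n)`:  `C_{<n}`, `C_1`, `C_n` and `C_n'`. -/
inductive Kind | lt | one | reg | prime
deriving DecidableEq

/-- Membership of a composition in each of the four families of `C(n)`. -/
def memC (n : ℕ) : Kind → List ℕ → Prop
  | .lt, q => (∀ x ∈ q, 0 < x) ∧ q.sum + 2 ≤ n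
  | .one, q => (∀ x ∈ q, 0 < x) ∧ q.sum = n ∧ q.headD 0 = 1
  | .reg, q => (∀ x ∈ q, 0 < x) ∧ q.sum = n ∧ 2 ≤ q.headD 0
  | .prime, q => (∀ x ∈ q, 0 < x) ∧ q.sum = n ∧ 2 ≤ q.headD 0

/-- The sum of the first `j` components of `q`. -/
def psum (q : List ℕ) (j : ℕ) : ℕ := (q.take j).sum

/-- The subset of generator indices (`0` standing for `s_{1'}`, `i ≥ 1` for `s_i`)
corresponding to `q ∈ C(n)`. -/
def JofC (n : ℕ) : Kind → List ℕ → Set ℕ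
  | .lt, q => {s | ∃ j < q.length, s = (n - q.sum) + psum q j}
  | .one, q => {0} ∪ {s | ∃ j, 1 ≤ j ∧ j < q.length ∧ s = psum q j}
  | .reg, q => {0} ∪ {s | ∃ j, 1 ≤ j ∧ j < q.length ∧ s = psum q j}
  | .prime, q => {1} ∪ {s | ∃ j, 1 ≤ j ∧ j < q.length ∧ s = psum q j}

/-- The basis element `B_q = 𝒳_{J^c}` of `ΣD_n`, for `q` in the family `k` of `C(n)`. -/
noncomputable def B (n : ℕ) (k : Kind) (q : List ℕ) :
    MonoidAlgebra ℚ (Equiv.Perm (Dom n)) :=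
  XX n (Set.Iio n \ JofC n k q)

/-- The descent algebra `ΣD_n`, as the `ℚ`-span of the elements `𝒳_J`. -/
noncomputable def SigmaD (n : ℕ) : Submodule ℚ (MonoidAlgebra ℚ (Equiv.Perm (Dom n))) :=
  Submodule.span ℚ {a | ∃ J ⊆ Set.Iio n, a = XX n J}

/-- The basis elements `B_q` for `q ∈ C_1 ∪ C_n ∪ C_n'`. -/
def idealGens (n : ℕ) : Set (MonoidAlgebra ℚ (Equiv.Perm (Dom n))) :=
  {a | ∃ k q, k ≠ Kind.lt ∧ memC n k q ∧ a = B n k q}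

/-- The `ℚ`-subspace `𝓘` spanned by `{B_q : q ∈ C_1 ∪ C_n ∪ C_n'}`. -/
noncomputable def IdealI (n : ℕ) : Submodule ℚ (MonoidAlgebra ℚ (Equiv.Perm (Dom n))) :=
  Submodule.span ℚ (idealGens n)

/-! ### Points and the generators -/

/-- The integer encoded by a point. -/
def val {n : ℕ} (a : Dom n) : ℤ := if a.2 then (a.1 : ℤ) + 1 else -((a.1 : ℤ) + 1)

/-- The point encoding the opposite integer. -/
def neg {n : ℕ} (a : Dom n) : Dom n := (a.1, !a.2)

@[simp] lemma neg_involutive {n : ℕ} (a : Dom n) : neg (neg a) = a := by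
  simp [neg]

@[simp] lemma val_neg {n : ℕ} (a : Dom n) : val (neg a) = -val a := by
  rcases a with ⟨k, _ | _⟩ <;> simp [neg, val]

lemma val_injective {n : ℕ} : Function.Injective (val (n := n)) := by
  rintro ⟨⟨k, hk⟩, b⟩ ⟨⟨l, hl⟩, c⟩ h
  cases b <;> cases c <;> simp [val] at h ⊢ <;> omega

lemma val_ne_zero {n : ℕ} (a : Dom n) : val a ≠ 0 := by
  rcases a with ⟨k, _ | _⟩ <;> simp [val] <;> omega

/-- The source of the simple root indexed by `s`, seen as an ordered pair of points. -/
def ra (n s : ℕ) : Dom n := if s = 0 then pt n (-1) else pt n s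

/-- The target of the simple root indexed by `s`, seen as an ordered pair of points. -/
def rb (n s : ℕ) : Dom n := if s = 0 then pt n 2 else pt n (s + 1)

lemma val_pt {n : ℕ} {a : ℤ} (h0 : a ≠ 0) (h : a.natAbs ≤ n) : val (pt n a) = a := by
  have h1 : (a.natAbs - 1) % (n + 1) = a.natAbs - 1 := Nat.mod_eq_of_lt (by omega)
  simp only [val, pt, h1, decide_eq_true_eq]
  split_ifs <;> omega

lemma val_ra {n s : ℕ} (hs : s < n) :
    val (ra n s) = if s = 0 then -1 else (s : ℤ) := by
  unfold ra; split_ifs with h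
  · exact val_pt (by omega) (by omega)
  · exact val_pt (by omega) (by omega)

lemma val_rb {n s : ℕ} (hn : 2 ≤ n) (hs : s < n) :
    val (rb n s) = if s = 0 then 2 else (s : ℤ) + 1 := by
  unfold rb; split_ifs with h
  · exact val_pt (by omega) (by omega)
  · exact val_pt (by omega) (by omega)

lemma pt_neg {n : ℕ} {a : ℤ} (h0 : a ≠ 0) : pt n (-a) = neg (pt n a) := by
  simp only [pt, neg, Int.natAbs_neg, Prod.mk.injEq, true_and]
  rcases lt_or_gt_of_ne h0 with h | h
  · simp [h, h.le]
  · simp [h, h.le]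

lemma gen_eq {n s : ℕ} :
    gen n s = Equiv.swap (neg (rb n s)) (neg (ra n s)) * Equiv.swap (ra n s) (rb n s) := by
  unfold gen ra rb swapD
  split_ifs with h
  · rw [← pt_neg (by omega), ← pt_neg (by omega)]; simp
  · rw [← pt_neg (by omega), ← pt_neg (by omega)]; ring_nf

lemma gen_apply {n s : ℕ} (hn : 2 ≤ n) (hs : s < n) (a : Dom n) :
    gen n s a = if a = ra n s then rb n s else if a = rb n s then ra n s
      else if a = neg (ra n s) then neg (rb n s) else if a = neg (rb n s) then neg (ra n s)
      else a := by
  have e1 := val_ra hs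
  have e2 := val_rb hn hs
  have e3 := val_neg (ra n s)
  have e4 := val_neg (rb n s)
  have h1 : ra n s ≠ neg (ra n s) := fun h => by have := congrArg val h; grind
  have h2 : rb n s ≠ neg (rb n s) := fun h => by have := congrArg val h; grind
  have h3 : ra n s ≠ neg (rb n s) := fun h => by have := congrArg val h; grind
  have h4 : rb n s ≠ neg (ra n s) := fun h => by have := congrArg val h; grind
  rw [gen_eq, Equiv.Perm.mul_apply]
  simp only [Equiv.swap_apply_def]
  grind

lemma gen_mul_self {n s : ℕ} (hn : 2 ≤ n) (hs : s < n) : gen n s * gen n s = 1 := by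
  have e1 := val_ra hs
  have e2 := val_rb hn hs
  have e3 := val_neg (ra n s)
  have e4 := val_neg (rb n s)
  have h1 : ra n s ≠ neg (ra n s) := fun h => by have := congrArg val h; grind
  have h2 : rb n s ≠ neg (rb n s) := fun h => by have := congrArg val h; grind
  have h3 : ra n s ≠ neg (rb n s) := fun h => by have := congrArg val h; grind
  have h4 : rb n s ≠ neg (ra n s) := fun h => by have := congrArg val h; grind
  ext1 a
  rw [Equiv.Perm.mul_apply, Equiv.Perm.one_apply]
  simp only [gen_apply hn hs]
  grind

lemma gen_gen {n s : ℕ} (hn : 2 ≤ n) (hs : s < n) (a : Dom n) :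
    gen n s (gen n s a) = a := by
  rw [← Equiv.Perm.mul_apply, gen_mul_self hn hs, Equiv.Perm.one_apply]

lemma val_gen {n s : ℕ} (hn : 2 ≤ n) (hs : s < n) (a : Dom n) :
    val (gen n s a) = if val a = val (ra n s) then val (rb n s)
      else if val a = val (rb n s) then val (ra n s)
      else if val a = -val (ra n s) then -val (rb n s)
      else if val a = -val (rb n s) then -val (ra n s) else val a := by
  rw [gen_apply hn hs]
  simp only [← val_neg, val_injective.eq_iff]
  split_ifs <;> rfl

lemma gen_mem {n s : ℕ} (hs : s < n) : gen n s ∈ Dgroup n :=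
  Subgroup.subset_closure ⟨s, hs, rfl⟩

/-! ### Elements of the group -/

lemma map_neg_of_mem {n : ℕ} (hn : 2 ≤ n) {w : Equiv.Perm (Dom n)} (hw : w ∈ Dgroup n) :
    ∀ a, w (neg a) = neg (w a) := by
  induction hw using Subgroup.closure_induction with
  | mem x hx =>
    obtain ⟨s, hs, rfl⟩ := hx
    intro a
    apply val_injective
    rw [val_neg, val_gen hn hs, val_gen hn hs, val_neg]
    have e1 := val_ra hs
    have e2 := val_rb hn hs
    rw [e1, e2]
    split_ifs <;> omega
  | one => simp
  | mul x y _ _ hx hy => intro a; simp [hx, hy]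
  | inv x _ hx => intro a; rw [Equiv.Perm.inv_eq_iff_eq, hx]; simp

lemma map_eq_of_mem {n : ℕ} (hn : 2 ≤ n) {w : Equiv.Perm (Dom n)} (hw : w ∈ Dgroup n) :
    ∀ a : Dom n, ¬ a.1.val < n → w a = a := by
  induction hw using Subgroup.closure_induction with
  | mem x hx =>
    obtain ⟨s, hs, rfl⟩ := hx
    intro a ha
    apply val_injective
    rw [val_gen hn hs, val_ra hs, val_rb hn hs]
    have hs' : s < n := hs
    simp only [val]
    split_ifs <;> omega
  | one => simp
  | mul x y _ _ hx hy => intro a h; simp [hx a h, hy a h]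
  | inv x _ hx => intro a h; rw [Equiv.Perm.inv_eq_iff_eq, hx a h]

lemma map_lt_iff_of_mem {n : ℕ} (hn : 2 ≤ n) {w : Equiv.Perm (Dom n)} (hw : w ∈ Dgroup n)
    (a : Dom n) : (w a).1.val < n ↔ a.1.val < n := by
  constructor
  · intro h; by_contra h'; rw [map_eq_of_mem hn hw a h'] at h; exact h' h
  · intro h; by_contra h'
    have := w.injective (map_eq_of_mem hn hw _ h')
    rw [this] at h'; exact h' h

lemma sign_of_mem {n : ℕ} (hn : 2 ≤ n) {w : Equiv.Perm (Dom n)} (hw : w ∈ Dgroup n) :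
    Equiv.Perm.sign w = 1 := by
  induction hw using Subgroup.closure_induction with
  | mem x hx =>
    obtain ⟨s, hs, rfl⟩ := hx
    have e1 := val_ra hs
    have e2 := val_rb hn hs
    have h : ra n s ≠ rb n s := fun h => by have := congrArg val h; grind
    have h' : neg (rb n s) ≠ neg (ra n s) := fun h0 => h (by
      have := congrArg neg h0; simpa using this.symm)
    rw [gen_eq, map_mul, Equiv.Perm.sign_swap h, Equiv.Perm.sign_swap h']; rfl
  | one => simp
  | mul x y _ _ hx hy => simp [hx, hy]
  | inv x _ hx => simp [hx]

/-- Ordered pairs of points that encode roots of `D_n`. -/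
def IsRoot (n : ℕ) (a b : Dom n) : Prop :=
  a.1.val < n ∧ b.1.val < n ∧ b ≠ a ∧ b ≠ neg a

lemma isRoot_iff {n : ℕ} {a b : Dom n} :
    IsRoot n a b ↔ a.1.val < n ∧ b.1.val < n ∧ a.1.val ≠ b.1.val := by
  rcases a with ⟨⟨k, hk⟩, _ | _⟩ <;> rcases b with ⟨⟨l, hl⟩, _ | _⟩ <;>
    simp [IsRoot, neg] <;> omega

lemma isRoot_map {n : ℕ} (hn : 2 ≤ n) {w : Equiv.Perm (Dom n)} (hw : w ∈ Dgroup n)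
    (a b : Dom n) : IsRoot n (w a) (w b) ↔ IsRoot n a b := by
  unfold IsRoot
  rw [map_lt_iff_of_mem hn hw, map_lt_iff_of_mem hn hw, ← map_neg_of_mem hn hw]
  simp

lemma isRoot_simple {n s : ℕ} (hn : 2 ≤ n) (hs : s < n) : IsRoot n (ra n s) (rb n s) := by
  have e1 := val_ra hs
  have e2 := val_rb hn hs
  rw [isRoot_iff]
  unfold val at e1 e2
  split_ifs at e1 e2 <;> omega

lemma val_ra_lt {n s : ℕ} (hn : 2 ≤ n) (hs : s < n) : val (ra n s) < val (rb n s) := by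
  rw [val_ra hs, val_rb hn hs]; split_ifs <;> omega

lemma IsRoot.val_ne {n : ℕ} {a b : Dom n} (h : IsRoot n a b) : val a ≠ val b :=
  fun e => h.2.2.1 (val_injective e).symm

lemma IsRoot.symm {n : ℕ} {a b : Dom n} (h : IsRoot n a b) : IsRoot n b a := by
  rw [isRoot_iff] at *; tauto

/-! ### Length and the exchange property -/

lemma eq_simple_of_gen_neg {n s : ℕ} (hn : 2 ≤ n) (hs : s < n) {a b : Dom n}
    (h : IsRoot n a b) (hab : val a < val b) (hneg : val (gen n s b) < val (gen n s a)) :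
    (a = ra n s ∧ b = rb n s) ∨ (a = neg (rb n s) ∧ b = neg (ra n s)) := by
  have h2 : val b ≠ - val a := fun e => h.2.2.2 (val_injective (by rw [e, val_neg]))
  have ha := val_ne_zero a
  have hb := val_ne_zero b
  simp only [← (val_injective (n := n)).eq_iff, val_neg]
  rw [val_gen hn hs, val_gen hn hs] at hneg
  rw [val_ra hs, val_rb hn hs] at *
  split_ifs at hneg ⊢ <;> omega

lemma gen_conj {n s t : ℕ} (hn : 2 ≤ n) (hs : s < n) (ht : t < n)
    {w : Equiv.Perm (Dom n)} (hw : w ∈ Dgroup n) (h : (w (ra n s) = ra n t ∧ w (rb n s) = rb n t) ∨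
      (w (ra n s) = neg (rb n t) ∧ w (rb n s) = neg (ra n t))) :
    gen n t * w = w * gen n s := by
  have e1 := val_ra ht
  have e2 := val_rb hn ht
  have e3 := val_neg (ra n t)
  have e4 := val_neg (rb n t)
  have h1 : ra n t ≠ neg (ra n t) := fun h => by have := congrArg val h; grind
  have h2 : rb n t ≠ neg (rb n t) := fun h => by have := congrArg val h; grind
  have h3 : ra n t ≠ neg (rb n t) := fun h => by have := congrArg val h; grind
  have h4 : rb n t ≠ neg (ra n t) := fun h => by have := congrArg val h; grind
  have h5 : ra n t ≠ rb n t := fun h => by have := congrArg val h; grind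
  have e5 := map_neg_of_mem hn hw (ra n s)
  have e6 := map_neg_of_mem hn hw (rb n s)
  have e7 := neg_involutive (ra n t)
  have e8 := neg_involutive (rb n t)
  ext1 a
  simp only [Equiv.Perm.mul_apply, gen_apply hn hs, gen_apply hn ht]
  have i1 := w.injective.eq_iff (a := a) (b := ra n s)
  have i2 := w.injective.eq_iff (a := a) (b := rb n s)
  have i3 := w.injective.eq_iff (a := a) (b := neg (ra n s))
  have i4 := w.injective.eq_iff (a := a) (b := neg (rb n s))
  clear e1 e2 e3 e4 hw
  rcases h with ⟨j1, j2⟩ | ⟨j1, j2⟩ <;> grind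

lemma prod_mem {n : ℕ} {l : List ℕ} (h : ∀ i ∈ l, i < n) : (l.map (gen n)).prod ∈ Dgroup n := by
  apply Subgroup.list_prod_mem
  intro x hx
  obtain ⟨i, hi, rfl⟩ := List.mem_map.1 hx
  exact gen_mem (h i hi)

lemma exists_shorter_word {n s : ℕ} (hn : 2 ≤ n) (hs : s < n) (l : List ℕ) (hl : ∀ i ∈ l, i < n)
    (h : val ((l.map (gen n)).prod (rb n s)) < val ((l.map (gen n)).prod (ra n s))) :
    ∃ l' : List ℕ, (∀ i ∈ l', i < n) ∧ l'.length + 1 = l.length ∧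
      (l'.map (gen n)).prod = (l.map (gen n)).prod * gen n s := by
  induction l with
  | nil => simp at h; exact absurd (val_ra_lt hn hs) h.not_gt
  | cons i l ih =>
    have hi : i < n := hl i (by simp)
    have hl' : ∀ i ∈ l, i < n := fun j hj => hl j (by simp [hj])
    have hw := prod_mem hl'
    have hr := (isRoot_map hn hw _ _).2 (isRoot_simple hn hs)
    rcases lt_or_gt_of_ne hr.val_ne with hpos | hneg
    · simp only [List.map_cons, List.prod_cons, Equiv.Perm.mul_apply] at h
      have hc := gen_conj hn hs hi hw (eq_simple_of_gen_neg hn hi hr hpos h)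
      refine ⟨l, hl', by simp, ?_⟩
      simp only [List.map_cons, List.prod_cons]
      rw [hc, mul_assoc, gen_mul_self hn hs, mul_one]
    · obtain ⟨l', h1, h2, h3⟩ := ih hl' hneg
      refine ⟨i :: l', ?_, by simp [h2], by simp [h3, mul_assoc]⟩
      intro j hj
      rcases List.mem_cons.1 hj with rfl | hj
      · exact hi
      · exact h1 j hj

lemma exists_word {n : ℕ} (hn : 2 ≤ n) {w : Equiv.Perm (Dom n)} (hw : w ∈ Dgroup n) :
    ∃ l : List ℕ, (∀ i ∈ l, i < n) ∧ (l.map (gen n)).prod = w := by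
  induction hw using Subgroup.closure_induction with
  | mem x hx =>
    obtain ⟨s, hs, rfl⟩ := hx
    exact ⟨[s], by simpa using hs, by simp⟩
  | one => exact ⟨[], by simp, by simp⟩
  | mul x y _ _ hx hy =>
    obtain ⟨l, h1, rfl⟩ := hx
    obtain ⟨m, h2, rfl⟩ := hy
    refine ⟨l ++ m, ?_, by simp⟩
    intro i hi
    rcases List.mem_append.1 hi with hi | hi
    · exact h1 i hi
    · exact h2 i hi
  | inv x _ hx =>
    obtain ⟨l, h1, rfl⟩ := hx
    refine ⟨l.reverse, by simpa using h1, ?_⟩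
    rw [List.prod_inv_reverse, List.map_map, List.map_reverse]
    congr 2
    refine List.map_congr_left fun i hi => ?_
    exact eq_inv_of_mul_eq_one_left (gen_mul_self hn (h1 i hi))

lemma len_mul_gen_lt {n s : ℕ} (hn : 2 ≤ n) (hs : s < n) {w : Equiv.Perm (Dom n)}
    (hw : w ∈ Dgroup n) (h : val (w (rb n s)) < val (w (ra n s))) :
    len n (w * gen n s) < len n w := by
  have hne : {k | ∃ l : List ℕ, (∀ i ∈ l, i < n) ∧ l.length = k ∧
      (l.map (gen n)).prod = w}.Nonempty := by
    obtain ⟨l, h1, h2⟩ := exists_word hn hw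
    exact ⟨_, l, h1, rfl, h2⟩
  obtain ⟨l, h1, h2, rfl⟩ := Nat.sInf_mem hne
  obtain ⟨l', h3, h4, h5⟩ := exists_shorter_word hn hs l h1 h
  have : len n ((l.map (gen n)).prod * gen n s) ≤ l'.length :=
    Nat.sInf_le ⟨l', h3, rfl, h5⟩
  have e : len n (l.map (gen n)).prod = l.length := h2.symm
  omega

/-! ### Vectors and dominance -/

/-- Vectors of the reflection representation, as odd functions on the points. -/
def IsOdd {n : ℕ} (v : Dom n → ℤ) : Prop := ∀ a, v (neg a) = -v a

/-- Nonnegativity on the simple roots. -/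
def Dominant {n : ℕ} (v : Dom n → ℤ) : Prop := ∀ s < n, v (ra n s) ≤ v (rb n s)

lemma isOdd_val {n : ℕ} : IsOdd (val (n := n)) := val_neg

lemma IsOdd.comp {n : ℕ} (hn : 2 ≤ n) {v : Dom n → ℤ} (hv : IsOdd v) {w : Equiv.Perm (Dom n)}
    (hw : w ∈ Dgroup n) : IsOdd (v ∘ w) := fun a => by
  simp only [Function.comp_apply, map_neg_of_mem hn hw, hv (w a)]

lemma IsOdd.lin {n : ℕ} {v u : Dom n → ℤ} (hv : IsOdd v) (hu : IsOdd u) (M N : ℤ) :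
    IsOdd (fun a => M * v a + N * u a) := fun a => by
  simp only [hv a, hu a]; ring

lemma dominant_le {n : ℕ} (hn : 2 ≤ n) {v : Dom n → ℤ} (hv : IsOdd v) (hd : Dominant v)
    {a b : Dom n} (h : IsRoot n a b) (hab : val a < val b) : v a ≤ v b := by
  set g : ℕ → ℤ := fun k => v (pt n (k + 1)) with hg
  have hstep : ∀ k, k + 1 < n → g k ≤ g (k + 1) := by
    intro k hk
    have := hd (k + 1) hk
    simpa [ra, rb, hg] using this
  have h0 : -g 0 ≤ g 1 := by
    have := hd 0 (by omega)
    simp only [ra, rb, if_true, pt_neg one_ne_zero, hv (pt n 1)] at this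
    simpa [hg, one_add_one_eq_two] using this
  have hmono : ∀ i j, i ≤ j → j < n → g i ≤ g j := by
    intro i j hij
    induction j, hij using Nat.le_induction with
    | base => intro _; exact le_rfl
    | succ j _ ih => intro hj; exact (ih (by omega)).trans (hstep j hj)
  have hneg : ∀ i j, i ≠ j → i < n → j < n → -g i ≤ g j := by
    intro i j hij hi hj
    have h01 := hstep 0 (by omega)
    rcases Nat.eq_zero_or_pos i with rfl | hi0
    · exact h0.trans (hmono 1 j (by omega) hj)
    · rcases Nat.eq_zero_or_pos j with rfl | hj0
      · have := hmono 1 i (by omega) hi; linarith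
      · have := hmono 1 i (by omega) hi
        have := hmono 1 j (by omega) hj
        simp only [zero_add] at h01
        linarith
  have hshape : ∀ a : Dom n, v a = if a.2 then g a.1.val else - g a.1.val := by
    have key : ∀ k : Fin (n + 1), g k.val = v (k, true) := by
      intro k
      have : ((k : ℤ) + 1).natAbs - 1 = k.val := by omega
      simp only [hg, pt, this, Nat.mod_eq_of_lt k.isLt]
      congr 2
      simp
    rintro ⟨k, _ | _⟩
    · simp only [key, ← hv (k, true)]; rfl
    · simp [key]
  rw [isRoot_iff] at h
  obtain ⟨ha, hb, hne⟩ := h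
  rw [hshape a, hshape b]
  simp only [val] at hab
  split_ifs at hab ⊢
  · exact hmono _ _ (by omega) hb
  · omega
  · exact hneg _ _ hne ha hb
  · exact neg_le_neg (hmono _ _ (by omega) ha)

lemma exists_bound {n : ℕ} (u : Dom n → ℤ) : ∃ M : ℤ, 0 < M ∧ ∀ a b, |u b - u a| < M := by
  refine ⟨1 + ∑ p : Dom n × Dom n, |u p.2 - u p.1|, ?_, ?_⟩
  · have := Finset.sum_nonneg (s := Finset.univ)
      (fun (p : Dom n × Dom n) _ => abs_nonneg (u p.2 - u p.1))
    linarith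
  · intro a b
    have := Finset.single_le_sum (f := fun p : Dom n × Dom n => |u p.2 - u p.1|)
      (fun p _ => abs_nonneg _) (Finset.mem_univ (a, b))
    simp only at this
    linarith

lemma eq_of_dominant {n : ℕ} (hn : 2 ≤ n) {v u : Dom n → ℤ} (hv : IsOdd v) (hu : IsOdd u)
    (hvd : Dominant v) (hud : Dominant u)
    (h : ∀ s < n, u (ra n s) = u (rb n s) → v (ra n s) = v (rb n s))
    {a b : Dom n} (hab : IsRoot n a b) (he : u a = u b) : v a = v b := by
  wlog hlt : val a < val b generalizing a b
  · exact (this hab.symm he.symm (lt_of_le_of_ne (not_lt.1 hlt) hab.symm.val_ne)).symm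
  obtain ⟨M, hM, hb⟩ := exists_bound v
  have hd : Dominant (fun a => M * u a + (-1) * v a) := by
    intro s hs
    rcases (hud s hs).eq_or_lt with h0 | h0
    · simp only [h0, h s hs h0]; exact le_rfl
    · have := (abs_lt.1 (hb (ra n s) (rb n s))).2
      simp only
      nlinarith
  have h1 := dominant_le hn (hu.lin hv M (-1)) hd hab hlt
  have h2 := dominant_le hn hv hvd hab hlt
  simp only [he] at h1
  linarith

lemma exists_dominant {n : ℕ} (hn : 2 ≤ n) {v : Dom n → ℤ} (hv : IsOdd v) :
    ∃ w ∈ Dgroup n, Dominant (v ∘ w) := by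
  obtain ⟨⟨w, hw⟩, hmax⟩ := Finite.exists_max
    (fun w : Dgroup n => ∑ a, val a * v ((w : Equiv.Perm (Dom n)) a))
  refine ⟨w, hw, fun s hs => ?_⟩
  by_contra hlt
  rw [not_le] at hlt
  have h1 := hmax ⟨w * gen n s, mul_mem hw (gen_mem hs)⟩
  simp only [Equiv.Perm.mul_apply] at h1
  rw [← Equiv.sum_comp (gen n s)] at h1
  simp only [gen_gen hn hs] at h1
  have e1 := val_ra (n := n) hs
  have e2 := val_rb hn hs
  have hlt' := val_ra_lt hn hs
  have key : ∀ a, val (gen n s a) - val a = (val (rb n s) - val (ra n s)) *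
      ((if a = ra n s then 1 else 0) - (if a = rb n s then 1 else 0)
        - (if a = neg (ra n s) then 1 else 0) + (if a = neg (rb n s) then 1 else 0)) := by
    intro a
    rw [val_gen hn hs]
    simp only [← val_injective.eq_iff, val_neg]
    rw [e1, e2]
    split_ifs <;> simp_all <;> omega
  have h2 : ∑ a, (val (gen n s a) - val a) * v (w a) =
      2 * ((val (rb n s) - val (ra n s)) * (v (w (ra n s)) - v (w (rb n s)))) := by
    simp only [key, mul_assoc, add_mul, sub_mul, ← Finset.mul_sum, Finset.sum_add_distrib,
      Finset.sum_sub_distrib, ite_mul, one_mul, zero_mul, Finset.sum_ite_eq', Finset.mem_univ,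
      if_true, map_neg_of_mem hn hw, hv (w _)]
    ring
  simp only [sub_mul, Finset.sum_sub_distrib] at h2
  have : 0 < (val (rb n s) - val (ra n s)) * (v (w (ra n s)) - v (w (rb n s))) :=
    mul_pos (by linarith) (by simpa using hlt)
  linarith

lemma eq_one_of_val_lt {n : ℕ} (hn : 2 ≤ n) {w : Equiv.Perm (Dom n)} (hw : w ∈ Dgroup n)
    (h : ∀ s < n, val (w (ra n s)) < val (w (rb n s))) : w = 1 := by
  have hlt : ∀ a b, IsRoot n a b → val a < val b → val (w a) < val (w b) := fun a b hr hab =>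
    lt_of_le_of_ne (dominant_le hn (isOdd_val.comp hn hw) (fun s hs => (h s hs).le) hr hab)
      ((isRoot_map hn hw a b).2 hr).val_ne
  have hpair : ∀ i j : Fin (n + 1), i < j → (w (i, true)).1 < (w (j, true)).1 ∧
      (w (j, true)).2 = true := by
    intro i j hij
    have hij' : i.val < j.val := hij
    have hneg : (i, false) = neg ((i, true) : Dom n) := rfl
    by_cases hj : j.val < n
    · have h1 := hlt (i, true) (j, true) (isRoot_iff.2 ⟨by simp; omega, hj, by simp; omega⟩)
        (by simp [val]; omega)
      have h2 := hlt (i, false) (j, true) (isRoot_iff.2 ⟨by simp; omega, hj, by simp; omega⟩)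
        (by simp [val]; omega)
      rw [hneg, map_neg_of_mem hn hw, val_neg] at h2
      rw [Fin.lt_def]
      simp only [val] at h1 h2
      split_ifs at h1 h2 with h3 h4 <;> simp_all <;> omega
    · rw [map_eq_of_mem hn hw (j, true) hj]
      have : (w (i, true)).1.val < n := (map_lt_iff_of_mem hn hw _).2 (by simp; omega)
      refine ⟨?_, rfl⟩
      rw [Fin.lt_def]
      simp only
      omega
  have hid : (fun i => (w (i, true)).1) = id := by
    have hm : StrictMono (fun i => (w (i, true)).1) := fun i j hij => (hpair i j hij).1
    exact hm.eq_id
  have hfix : ∀ i : Fin (n + 1), 0 < i → w (i, true) = (i, true) := fun i hi =>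
    Prod.ext (congrFun hid i) (hpair 0 i hi).2
  have hneg : ∀ i, ((i, false) : Dom n) = neg (i, true) := fun _ => rfl
  rcases hb : (w (0, true)).2 with _ | _
  · have h0 : w (0, true) = (0, false) := Prod.ext (congrFun hid 0) hb
    have hsw : w = Equiv.swap (0, true) (0, false) := by
      ext1 ⟨i, b⟩
      rcases (Fin.zero_le i).eq_or_lt with rfl | hi
      · cases b
        · rw [hneg, map_neg_of_mem hn hw, h0]; simp [neg]
        · simp [h0]
      · rw [Equiv.swap_apply_of_ne_of_ne (by simp [hi.ne']) (by simp [hi.ne'])]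
        cases b
        · rw [hneg, map_neg_of_mem hn hw, hfix i hi]
        · exact hfix i hi
    have h1 := sign_of_mem hn hw
    rw [hsw, Equiv.Perm.sign_swap (by simp)] at h1
    exact absurd h1 (by decide)
  · have h0 : w (0, true) = (0, true) := Prod.ext (congrFun hid 0) hb
    ext1 ⟨i, b⟩
    have hi : w (i, true) = (i, true) := by
      rcases (Fin.zero_le i).eq_or_lt with rfl | hi
      · exact h0
      · exact hfix i hi
    cases b
    · rw [hneg, map_neg_of_mem hn hw, hi]; rfl
    · exact hi

/-! ### Faces of the Coxeter complex, as sign vectors on the roots -/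

/-- Sign vectors indexed by pairs of points. -/
abbrev Face (n : ℕ) := Dom n → Dom n → SignType

/-- The sign vector of `v` on the roots. -/
noncomputable def sgn {n : ℕ} (v : Dom n → ℤ) : Face n :=
  fun a b => if IsRoot n a b then SignType.sign (v b - v a) else 0

/-- The action of permutations on sign vectors. -/
def act {n : ℕ} (w : Equiv.Perm (Dom n)) (f : Face n) : Face n := fun a b => f (w⁻¹ a) (w⁻¹ b)

/-- The Tits product of sign vectors. -/
noncomputable def fmul {n : ℕ} (f g : Face n) : Face n :=
  fun a b => if f a b = 0 then g a b else f a b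

/-- The fundamental chamber. -/
noncomputable def chamber (n : ℕ) : Face n := sgn val

/-- The sign vectors realised by a vector. -/
def IsFace {n : ℕ} (f : Face n) : Prop := ∃ v : Dom n → ℤ, IsOdd v ∧ sgn v = f

lemma act_mul {n : ℕ} (x y : Equiv.Perm (Dom n)) (f : Face n) :
    act (x * y) f = act x (act y f) := by
  funext a b; simp [act]

lemma act_one {n : ℕ} (f : Face n) : act 1 f = f := rfl

lemma act_inv_act {n : ℕ} (x : Equiv.Perm (Dom n)) (f : Face n) : act x⁻¹ (act x f) = f := by
  rw [← act_mul, inv_mul_cancel, act_one]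

lemma act_act_inv {n : ℕ} (x : Equiv.Perm (Dom n)) (f : Face n) : act x (act x⁻¹ f) = f := by
  rw [← act_mul, mul_inv_cancel, act_one]

lemma act_injective {n : ℕ} (x : Equiv.Perm (Dom n)) : Function.Injective (act x) :=
  Function.LeftInverse.injective (act_inv_act x)

lemma act_fmul {n : ℕ} (x : Equiv.Perm (Dom n)) (f g : Face n) :
    act x (fmul f g) = fmul (act x f) (act x g) := rfl

lemma fmul_assoc {n : ℕ} (f g h : Face n) : fmul (fmul f g) h = fmul f (fmul g h) := by
  funext a b; unfold fmul; split_ifs <;> simp_all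

lemma act_sgn {n : ℕ} (hn : 2 ≤ n) {w : Equiv.Perm (Dom n)} (hw : w ∈ Dgroup n)
    (v : Dom n → ℤ) : act w (sgn v) = sgn (v ∘ ⇑w⁻¹) := by
  funext a b
  simp only [act, sgn, isRoot_map hn (inv_mem hw), Function.comp_apply]

lemma IsFace.act {n : ℕ} (hn : 2 ≤ n) {f : Face n} (hf : IsFace f) {w : Equiv.Perm (Dom n)}
    (hw : w ∈ Dgroup n) : IsFace (act w f) := by
  obtain ⟨v, hv, rfl⟩ := hf
  exact ⟨_, hv.comp hn (inv_mem hw), (act_sgn hn hw v).symm⟩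

lemma exists_fmul_sgn {n : ℕ} (v u : Dom n → ℤ) :
    ∃ M : ℤ, 0 < M ∧ (∀ a b, |u b - u a| < M) ∧
      fmul (sgn v) (sgn u) = sgn (fun a => M * v a + 1 * u a) := by
  obtain ⟨M, hM, hb⟩ := exists_bound u
  refine ⟨M, hM, hb, ?_⟩
  funext a b
  unfold fmul sgn
  by_cases hr : IsRoot n a b
  · simp only [hr, if_true, sign_eq_zero_iff]
    have := abs_lt.1 (hb a b)
    rcases lt_trichotomy (v b - v a) 0 with h | h | h
    · rw [if_neg h.ne, sign_neg h, sign_neg (by nlinarith)]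
    · rw [if_pos h, sub_eq_zero.1 h]; congr 1; ring
    · rw [if_neg h.ne', sign_pos h, sign_pos (by nlinarith)]
  · simp [hr]

lemma IsFace.fmul {n : ℕ} {f g : Face n} (hf : IsFace f) (hg : IsFace g) :
    IsFace (fmul f g) := by
  obtain ⟨v, hv, rfl⟩ := hf
  obtain ⟨u, hu, rfl⟩ := hg
  obtain ⟨M, -, -, h⟩ := exists_fmul_sgn v u
  exact ⟨_, hv.lin hu M 1, h.symm⟩

lemma dominant_val {n : ℕ} (hn : 2 ≤ n) : Dominant (val (n := n)) :=
  fun _ hs => (val_ra_lt hn hs).le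

/-- A vector that is positive on the simple roots lies in the fundamental chamber. -/
lemma sgn_eq_chamber {n : ℕ} (hn : 2 ≤ n) {v : Dom n → ℤ} (hv : IsOdd v)
    (h : ∀ s < n, v (ra n s) < v (rb n s)) : sgn v = chamber n := by
  have hd : Dominant v := fun s hs => (h s hs).le
  have hlt : ∀ a b, IsRoot n a b → val a < val b → v a < v b := fun a b hr hab =>
    lt_of_le_of_ne (dominant_le hn hv hd hr hab) fun he =>
      hr.val_ne (eq_of_dominant hn isOdd_val hv (dominant_val hn) hd
        (fun s hs he => absurd he (h s hs).ne) hr he)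
  funext a b
  unfold chamber sgn
  split_ifs with hr
  · rcases lt_or_gt_of_ne hr.val_ne with hab | hab
    · rw [sign_pos (sub_pos.2 hab), sign_pos (sub_pos.2 (hlt a b hr hab))]
    · rw [sign_neg (sub_neg.2 hab), sign_neg (sub_neg.2 (hlt b a hr.symm hab))]
  · rfl

lemma act_chamber_injective {n : ℕ} (hn : 2 ≤ n) {x y : Equiv.Perm (Dom n)} (hx : x ∈ Dgroup n)
    (hy : y ∈ Dgroup n) (h : act x (chamber n) = act y (chamber n)) : x = y := by
  have hw : x⁻¹ * y ∈ Dgroup n := mul_mem (inv_mem hx) hy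
  have h1 : act (x⁻¹ * y)⁻¹ (chamber n) = chamber n := by
    rw [mul_inv_rev, inv_inv, act_mul, h, act_inv_act]
  suffices x⁻¹ * y = 1 from inv_mul_eq_one.1 this
  refine eq_one_of_val_lt hn hw fun s hs => ?_
  rw [chamber, act_sgn hn (inv_mem hw), inv_inv] at h1
  have h2 := congrFun (congrFun h1 (ra n s)) (rb n s)
  simp only [sgn, isRoot_simple hn hs, if_true, Function.comp_apply,
    sign_pos (sub_pos.2 (val_ra_lt hn hs)), sign_eq_one_iff] at h2
  linarith

/-- Dominance of a face: it lies in the closure of the fundamental chamber. -/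
lemma fmul_sgn_chamber {n : ℕ} (hn : 2 ≤ n) {v : Dom n → ℤ} (hv : IsOdd v) :
    fmul (sgn v) (chamber n) = chamber n ↔ Dominant v := by
  constructor
  · intro h s hs
    have h2 := congrFun (congrFun h (ra n s)) (rb n s)
    simp only [fmul, chamber, sgn, isRoot_simple hn hs, if_true,
      sign_pos (sub_pos.2 (val_ra_lt hn hs)), sign_eq_zero_iff] at h2
    split_ifs at h2 with h3
    · linarith
    · rw [sign_eq_one_iff] at h2; linarith
  · intro hd
    obtain ⟨M, hM, -, h⟩ := exists_fmul_sgn v (val (n := n))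
    rw [chamber, h]
    refine sgn_eq_chamber hn (hv.lin isOdd_val M 1) fun s hs => ?_
    have := hd s hs
    have := val_ra_lt hn hs
    nlinarith

lemma exists_act_chamber {n : ℕ} (hn : 2 ≤ n) {f : Face n} (hf : IsFace f) :
    ∃ w ∈ Dgroup n, act w (chamber n) = fmul f (chamber n) := by
  obtain ⟨v, hv, rfl⟩ := hf
  obtain ⟨M, hM, hb, h⟩ := exists_fmul_sgn v (val (n := n))
  set p : Dom n → ℤ := fun a => M * v a + 1 * val a with hp
  have hpo : IsOdd p := hv.lin isOdd_val M 1
  obtain ⟨w, hw, hd⟩ := exists_dominant hn hpo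
  refine ⟨w, hw, ?_⟩
  have hne : ∀ a b, IsRoot n a b → p a ≠ p b := by
    intro a b hr he
    have h1 : val b - val a = M * (v a - v b) := by simp only [hp] at he; linarith
    have h2 := hb a b
    have h3 := Int.eq_zero_of_abs_lt_dvd (Dvd.intro _ h1.symm) h2
    exact hr.val_ne (by linarith)
  have h1 : sgn (p ∘ w) = chamber n := sgn_eq_chamber hn (hpo.comp hn hw) fun s hs =>
    lt_of_le_of_ne (hd s hs) (hne _ _ ((isRoot_map hn hw _ _).2 (isRoot_simple hn hs)))
  have h2 : act w (chamber n) = sgn p := by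
    rw [← h1, act_sgn hn hw]
    congr 1
    funext a
    simp
  rw [h2, chamber, h]

lemma comp_gen {n s : ℕ} (hn : 2 ≤ n) (hs : s < n) {v : Dom n → ℤ} (hv : IsOdd v)
    (h : v (ra n s) = v (rb n s)) : v ∘ gen n s = v := by
  funext a
  rw [Function.comp_apply, gen_apply hn hs]
  have h1 := hv (ra n s)
  have h2 := hv (rb n s)
  split_ifs <;> simp_all

lemma act_gen {n s : ℕ} (hn : 2 ≤ n) (hs : s < n) {v : Dom n → ℤ} (hv : IsOdd v)
    (h : v (ra n s) = v (rb n s)) : act (gen n s) (sgn v) = sgn v := by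
  rw [act_sgn hn (gen_mem hs), inv_eq_of_mul_eq_one_left (gen_mul_self hn hs),
    comp_gen hn hs hv h]

/-- Two dominant faces in the same orbit are equal. -/
lemma act_eq_self_of_dominant {n : ℕ} (hn : 2 ≤ n) {v : Dom n → ℤ} (hv : IsOdd v)
    (h1 : fmul (sgn v) (chamber n) = chamber n) (w : Equiv.Perm (Dom n)) (hw : w ∈ Dgroup n)
    (h2 : fmul (act w (sgn v)) (chamber n) = chamber n) : act w (sgn v) = sgn v := by
  induction hk : len n w using Nat.strong_induction_on generalizing w with
  | _ k ih =>
  by_cases hpos : ∀ s < n, val (w (ra n s)) < val (w (rb n s))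
  · rw [eq_one_of_val_lt hn hw hpos, act_one]
  · push Not at hpos
    obtain ⟨s, hs, hle⟩ := hpos
    have hr := (isRoot_map hn hw _ _).2 (isRoot_simple hn hs)
    have hlt : val (w (rb n s)) < val (w (ra n s)) := lt_of_le_of_ne hle hr.symm.val_ne
    have hd := (fmul_sgn_chamber hn hv).1 h1 s hs
    rw [act_sgn hn hw, fmul_sgn_chamber hn (hv.comp hn (inv_mem hw))] at h2
    have hd2 := dominant_le hn (hv.comp hn (inv_mem hw)) h2 hr.symm hlt
    have hd2 : v (rb n s) ≤ v (ra n s) := by simpa using hd2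
    have hfix := act_gen hn hs hv (le_antisymm hd hd2)
    have hlen := len_mul_gen_lt hn hs hw hlt
    have := ih _ (hk ▸ hlen) (w * gen n s) (mul_mem hw (gen_mem hs)) (by
      rw [act_mul, hfix, act_sgn hn hw, fmul_sgn_chamber hn (hv.comp hn (inv_mem hw))]
      exact h2) rfl
    rwa [act_mul, hfix] at this

/-! ### Standard faces -/

/-- A dominant vector vanishing exactly on the simple roots indexed by `J`. -/
noncomputable def stdVec (n : ℕ) (J : Set ℕ) : Dom n → ℤ := fun a =>
  let d : ℕ → ℤ := fun s => if s ∈ J then 0 else 1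
  let g : ℤ := d 0 - d 1 + ∑ s ∈ Finset.Icc 1 a.1.val, 2 * d s
  if a.2 then g else -g

/-- The face of the fundamental chamber of type `J`. -/
noncomputable def stdFace (n : ℕ) (J : Set ℕ) : Face n := sgn (stdVec n J)

lemma isOdd_stdVec (n : ℕ) (J : Set ℕ) : IsOdd (stdVec n J) := by
  rintro ⟨k, _ | _⟩ <;> simp [stdVec, neg]

lemma stdVec_simple {n s : ℕ} (hn : 2 ≤ n) (hs : s < n) (J : Set ℕ) :
    stdVec n J (rb n s) - stdVec n J (ra n s) = if s ∈ J then 0 else 2 := by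
  rcases Nat.eq_zero_or_pos s with rfl | hpos
  · have h1 : 1 % (n + 1) = 1 := Nat.mod_eq_of_lt (by omega)
    simp only [stdVec, ra, rb, pt, if_true]
    simp [h1]
    split_ifs <;> norm_num
  · obtain ⟨k, rfl⟩ : ∃ k, s = k + 1 := ⟨s - 1, by omega⟩
    have h1 : k % (n + 1) = k := Nat.mod_eq_of_lt (by omega)
    have h2 : (k + 1) % (n + 1) = k + 1 := Nat.mod_eq_of_lt (by omega)
    have h3 : ((k : ℤ) + 1).natAbs = k + 1 := by omega
    have h4 : ((k : ℤ) + 1 + 1).natAbs = k + 1 + 1 := by omega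
    have h5 : (0 : ℤ) < k + 1 := by omega
    have h6 : (0 : ℤ) < k + 1 + 1 := by omega
    simp only [stdVec, ra, rb, pt]
    simp [h1, h2, h3, h4, h5, h6, Finset.sum_Icc_succ_top]

lemma dominant_stdVec {n : ℕ} (hn : 2 ≤ n) (J : Set ℕ) : Dominant (stdVec n J) := by
  intro s hs
  have := stdVec_simple hn hs J
  split_ifs at this <;> linarith

lemma stdVec_eq_iff {n s : ℕ} (hn : 2 ≤ n) (hs : s < n) (J : Set ℕ) :
    stdVec n J (ra n s) = stdVec n J (rb n s) ↔ s ∈ J := by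
  have := stdVec_simple hn hs J
  split_ifs at this with h <;> simp only [h, iff_true, iff_false] <;> [skip; intro he] <;> linarith

lemma stdFace_simple {n s : ℕ} (hn : 2 ≤ n) (hs : s < n) (J : Set ℕ) :
    stdFace n J (ra n s) (rb n s) = 0 ↔ s ∈ J := by
  rw [← stdVec_eq_iff hn hs, stdFace, sgn, if_pos (isRoot_simple hn hs), sign_eq_zero_iff,
    sub_eq_zero, eq_comm]

lemma isFace_stdFace (n : ℕ) (J : Set ℕ) : IsFace (stdFace n J) := ⟨_, isOdd_stdVec n J, rfl⟩

lemma stdFace_fmul_chamber {n : ℕ} (hn : 2 ≤ n) (J : Set ℕ) :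
    fmul (stdFace n J) (chamber n) = chamber n :=
  (fmul_sgn_chamber hn (isOdd_stdVec n J)).2 (dominant_stdVec hn J)

lemma act_stdFace {n : ℕ} (hn : 2 ≤ n) {J : Set ℕ} (hJ : J ⊆ Set.Iio n)
    {u : Equiv.Perm (Dom n)} (hu : u ∈ WJ n J) : act u (stdFace n J) = stdFace n J := by
  induction hu using Subgroup.closure_induction with
  | mem x hx =>
    obtain ⟨s, hs, rfl⟩ := hx
    exact act_gen hn (hJ hs) (isOdd_stdVec n J) ((stdVec_eq_iff hn (hJ hs) J).2 hs)
  | one => rfl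
  | mul x y _ _ hx hy => rw [act_mul, hy, hx]
  | inv x _ hx => conv_lhs => rw [← hx, act_inv_act]

lemma fmul_act_of_mem_X {n : ℕ} (hn : 2 ≤ n) {J : Set ℕ}
    {x : Equiv.Perm (Dom n)} (hx : x ∈ X n J) :
    fmul (act x (stdFace n J)) (chamber n) = act x (chamber n) := by
  obtain ⟨hxD, hmin⟩ := hx
  apply act_injective x⁻¹
  rw [act_fmul, act_inv_act, act_inv_act, chamber, act_sgn hn (inv_mem hxD), inv_inv, stdFace]
  obtain ⟨M, hM, hb, h⟩ := exists_fmul_sgn (stdVec n J) (val ∘ x)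
  rw [h]
  refine sgn_eq_chamber hn ((isOdd_stdVec n J).lin (isOdd_val.comp hn hxD) M 1) fun s hs => ?_
  have h1 := stdVec_simple hn hs J
  have h2 := abs_lt.1 (hb (ra n s) (rb n s))
  split_ifs at h1 with hsJ
  · have h3 : val (x (ra n s)) < val (x (rb n s)) := by
      by_contra hlt
      have hr := (isRoot_map hn hxD _ _).2 (isRoot_simple hn hs)
      have := len_mul_gen_lt hn hs hxD (lt_of_le_of_ne (not_lt.1 hlt) hr.symm.val_ne)
      exact absurd (hmin _ (Subgroup.subset_closure ⟨s, hsJ, rfl⟩)) this.not_ge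
    simp only [Function.comp_apply]
    nlinarith
  · nlinarith

lemma mem_X_iff {n : ℕ} (hn : 2 ≤ n) {J : Set ℕ} (hJ : J ⊆ Set.Iio n)
    {x : Equiv.Perm (Dom n)} : x ∈ X n J ↔
      x ∈ Dgroup n ∧ fmul (act x (stdFace n J)) (chamber n) = act x (chamber n) := by
  refine ⟨fun hx => ⟨hx.1, fmul_act_of_mem_X hn hx⟩, fun ⟨hx, h⟩ => ?_⟩
  obtain ⟨⟨u, hu⟩, hmin⟩ := Finite.exists_min (fun u : WJ n J => len n (x * u))
  have huD : u ∈ Dgroup n := Subgroup.closure_mono (Set.image_mono hJ) hu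
  have hxu : x * u ∈ X n J := by
    refine ⟨mul_mem hx huD, fun u' hu' => ?_⟩
    have := hmin ⟨u * u', mul_mem hu hu'⟩
    rwa [mul_assoc]
  have h1 := fmul_act_of_mem_X hn hxu
  rw [act_mul x u (stdFace n J), act_stdFace hn hJ hu, h] at h1
  rwa [act_chamber_injective hn hx hxu.1 h1]

/-! ### The product formula -/

/-- The orbit of the standard face of type `J`. -/
noncomputable def orbit (n : ℕ) (J : Set ℕ) : Finset (Face n) :=
  (Finset.univ.filter (· ∈ Dgroup n)).image (fun w => act w (stdFace n J))

lemma mem_orbit {n : ℕ} {J : Set ℕ} {f : Face n} :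
    f ∈ orbit n J ↔ ∃ w ∈ Dgroup n, act w (stdFace n J) = f := by
  simp [orbit]

lemma isFace_of_mem_orbit {n : ℕ} (hn : 2 ≤ n) {J : Set ℕ} {f : Face n} (hf : f ∈ orbit n J) :
    IsFace f := by
  obtain ⟨w, hw, rfl⟩ := mem_orbit.1 hf
  exact (isFace_stdFace n J).act hn hw

lemma act_mem_orbit {n : ℕ} {J : Set ℕ} {f : Face n} (hf : f ∈ orbit n J)
    {x : Equiv.Perm (Dom n)} (hx : x ∈ Dgroup n) : act x f ∈ orbit n J := by
  obtain ⟨w, hw, rfl⟩ := mem_orbit.1 hf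
  exact mem_orbit.2 ⟨x * w, mul_mem hx hw, act_mul x w _⟩

/-- The group element whose chamber is the projection of the fundamental chamber to `f`. -/
noncomputable def proj {n : ℕ} (f : Face n) : Equiv.Perm (Dom n) :=
  if h : ∃ w ∈ Dgroup n, act w (chamber n) = fmul f (chamber n) then h.choose else 1

lemma proj_mem {n : ℕ} (f : Face n) : proj f ∈ Dgroup n := by
  unfold proj
  split_ifs with h
  · exact h.choose_spec.1
  · exact one_mem _

lemma act_proj {n : ℕ} (hn : 2 ≤ n) {f : Face n} (hf : IsFace f) :
    act (proj f) (chamber n) = fmul f (chamber n) := by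
  have h := exists_act_chamber hn hf
  rw [proj, dif_pos h]
  exact h.choose_spec.2

lemma proj_eq {n : ℕ} (hn : 2 ≤ n) {f : Face n} {w : Equiv.Perm (Dom n)} (hw : w ∈ Dgroup n)
    (h : act w (chamber n) = fmul f (chamber n)) : proj f = w := by
  have h' : ∃ w ∈ Dgroup n, act w (chamber n) = fmul f (chamber n) := ⟨w, hw, h⟩
  rw [proj, dif_pos h']
  exact act_chamber_injective hn h'.choose_spec.1 hw (h'.choose_spec.2.trans h.symm)

lemma act_proj_inv_fmul {n : ℕ} (hn : 2 ≤ n) {f : Face n} (hf : IsFace f) :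
    fmul (act (proj f)⁻¹ f) (chamber n) = chamber n := by
  apply act_injective (proj f)
  rw [act_fmul, act_act_inv, act_proj hn hf, ← fmul_assoc]
  congr 1
  funext a b
  simp [fmul]

/-- Moving a face of type `J` back towards the fundamental chamber gives the standard face. -/
lemma act_proj_inv {n : ℕ} (hn : 2 ≤ n) {J : Set ℕ} {f : Face n} (hf : f ∈ orbit n J) :
    act (proj f)⁻¹ f = stdFace n J := by
  have h := act_proj_inv_fmul hn (isFace_of_mem_orbit hn hf)
  obtain ⟨w, hw, he⟩ := mem_orbit.1 hf
  rw [← he, ← act_mul, he] at h ⊢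
  exact act_eq_self_of_dominant hn (isOdd_stdVec n J) (stdFace_fmul_chamber hn J) _
    (mul_mem (inv_mem (proj_mem f)) hw) h

lemma XX_eq {n : ℕ} (hn : 2 ≤ n) {J : Set ℕ} (hJ : J ⊆ Set.Iio n) :
    XX n J = ∑ f ∈ orbit n J, MonoidAlgebra.of ℚ (Equiv.Perm (Dom n)) (proj f) := by
  unfold XX
  rw [← Finset.sum_filter]
  refine Finset.sum_bij' (fun x _ => act x (stdFace n J)) (fun f _ => proj f) ?_ ?_ ?_ ?_ ?_
  · intro x hx
    exact mem_orbit.2 ⟨x, (Finset.mem_filter.1 hx).2.1, rfl⟩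
  · intro f hf
    simp only [Finset.mem_filter, Finset.mem_univ, true_and]
    rw [mem_X_iff hn hJ, ← act_proj_inv hn hf, act_act_inv,
      act_proj hn (isFace_of_mem_orbit hn hf)]
    exact ⟨proj_mem f, rfl⟩
  · intro x hx
    have h := (mem_X_iff hn hJ).1 (Finset.mem_filter.1 hx).2
    exact proj_eq hn h.1 h.2.symm
  · intro f hf
    rw [← act_proj_inv hn hf, act_act_inv]
  · intro x hx
    have h := (mem_X_iff hn hJ).1 (Finset.mem_filter.1 hx).2
    rw [proj_eq hn h.1 h.2.symm]

lemma XX_mul_XX {n : ℕ} (hn : 2 ≤ n) {J K : Set ℕ} (hJ : J ⊆ Set.Iio n) (hK : K ⊆ Set.Iio n) :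
    XX n J * XX n K = ∑ p ∈ orbit n J ×ˢ orbit n K,
      MonoidAlgebra.of ℚ (Equiv.Perm (Dom n)) (proj (fmul p.2 p.1)) := by
  rw [XX_eq hn hJ, XX_eq hn hK, Finset.sum_mul_sum, Finset.sum_product]
  refine Finset.sum_congr rfl fun f hf => ?_
  refine Finset.sum_bij' (fun g _ => act (proj f) g) (fun g _ => act (proj f)⁻¹ g)
    (fun g hg => act_mem_orbit hg (proj_mem f))
    (fun g hg => act_mem_orbit hg (inv_mem (proj_mem f)))
    (fun g _ => act_inv_act _ g) (fun g _ => act_act_inv _ g) fun g hg => ?_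
  rw [← map_mul]
  congr 1
  refine (proj_eq hn (mul_mem (proj_mem f) (proj_mem g)) ?_).symm
  rw [act_mul, act_proj hn (isFace_of_mem_orbit hn hg), act_fmul,
    act_proj hn (isFace_of_mem_orbit hn hf), fmul_assoc]

lemma sgn_eq_of_dominant {n : ℕ} (hn : 2 ≤ n) {v u : Dom n → ℤ} (hv : IsOdd v) (hu : IsOdd u)
    (hvd : Dominant v) (hud : Dominant u)
    (h : ∀ s < n, u (ra n s) = u (rb n s) ↔ v (ra n s) = v (rb n s)) : sgn v = sgn u := by
  have key : ∀ a b, IsRoot n a b → (v a = v b ↔ u a = u b) := fun a b hr =>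
    ⟨eq_of_dominant hn hu hv hud hvd (fun s hs => (h s hs).2) hr,
      eq_of_dominant hn hv hu hvd hud (fun s hs => (h s hs).1) hr⟩
  have hpos : ∀ a b, IsRoot n a b → val a < val b →
      SignType.sign (v b - v a) = SignType.sign (u b - u a) ∧
      SignType.sign (v a - v b) = SignType.sign (u a - u b) := by
    intro a b hr hab
    have h1 := dominant_le hn hv hvd hr hab
    have h2 := dominant_le hn hu hud hr hab
    have h3 := key a b hr
    rcases h1.eq_or_lt with h4 | h4
    · rw [h4, h3.1 h4]; simp
    · have h5 : u a < u b := lt_of_le_of_ne h2 fun e => h4.ne (h3.2 e)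
      rw [sign_pos (sub_pos.2 h4), sign_pos (sub_pos.2 h5), sign_neg (sub_neg.2 h4),
        sign_neg (sub_neg.2 h5)]
      exact ⟨rfl, rfl⟩
  funext a b
  unfold sgn
  split_ifs with hr
  · rcases lt_or_gt_of_ne hr.val_ne with hab | hab
    · exact (hpos a b hr hab).1
    · exact (hpos b a hr.symm hab).2
  · rfl

/-- The type of a face, as a set of generator indices. -/
noncomputable def faceType {n : ℕ} (f : Face n) : Finset ℕ :=
  (Finset.range n).filter fun s => act (proj f)⁻¹ f (ra n s) (rb n s) = 0

lemma mem_orbit_iff_faceType {n : ℕ} (hn : 2 ≤ n) {f : Face n} (hf : IsFace f) {L : Finset ℕ}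
    (hL : L ⊆ Finset.range n) : f ∈ orbit n (L : Set ℕ) ↔ faceType f = L := by
  constructor
  · intro h
    unfold faceType
    rw [act_proj_inv hn h]
    ext s
    simp only [Finset.mem_filter, Finset.mem_range]
    constructor
    · rintro ⟨hs, h0⟩
      exact (stdFace_simple hn hs _).1 h0
    · intro hs
      have hs' := Finset.mem_range.1 (hL hs)
      exact ⟨hs', (stdFace_simple hn hs' _).2 hs⟩
  · rintro rfl
    have h1 := act_proj_inv_fmul hn hf
    obtain ⟨u, hu, he⟩ := hf.act hn (inv_mem (proj_mem f))
    rw [← he, fmul_sgn_chamber hn hu] at h1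
    refine mem_orbit.2 ⟨proj f, proj_mem f, ?_⟩
    have hstd : stdFace n (faceType f : Set ℕ) = sgn u := by
      refine sgn_eq_of_dominant hn (isOdd_stdVec n _) hu (dominant_stdVec hn _) h1 fun s hs => ?_
      rw [stdVec_eq_iff hn hs]
      simp [faceType, hs, ← he, sgn, isRoot_simple hn hs, sign_eq_zero_iff, sub_eq_zero]
      exact eq_comm
    rw [hstd, he, act_act_inv]

lemma simple_zero_of_dominant {n : ℕ} (hn : 2 ≤ n) {v : Dom n → ℤ} (hv : IsOdd v)
    (hd : Dominant v) {a b : Dom n} (hr : IsRoot n a b) (ha : v a = 0) (hb : v b = 0) :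
    v (ra n 0) = v (rb n 0) ∧ v (ra n 1) = v (rb n 1) := by
  obtain ⟨c, hc1, hcn, hc⟩ : ∃ c : Dom n, 1 ≤ c.1.val ∧ c.1.val < n ∧ v c = 0 := by
    rw [isRoot_iff] at hr
    by_cases h : 1 ≤ a.1.val
    · exact ⟨a, h, hr.1, ha⟩
    · exact ⟨b, by omega, hr.2.1, hb⟩
  have hq : v (c.1, true) = 0 := by
    rcases c with ⟨k, _ | _⟩
    · have := hv (k, false)
      rw [hc] at this
      simpa [neg] using this
    · exact hc
  have e1 : ra n 0 = neg (ra n 1) := by simp [ra, pt_neg]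
  have e2 : rb n 0 = rb n 1 := by simp [rb, one_add_one_eq_two]
  have h0 := hd 0 (by omega)
  have h1 := hd 1 (by omega)
  rw [e1, e2, hv] at h0
  have h2 : v (rb n 1) ≤ 0 := by
    have hv1 := val_rb hn (show 1 < n by omega)
    have hshape : rb n 1 = (⟨1, by omega⟩, true) := val_injective (by rw [hv1]; simp [val])
    by_cases h : c.1.val = 1
    · have : rb n 1 = (c.1, true) := by rw [hshape]; ext <;> simp [h]
      rw [this, hq]
    · rw [← hq]
      refine dominant_le hn hv hd ?_ ?_
      · rw [isRoot_iff, hshape]; simp only; omega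
      · rw [hv1]; simp [val]; omega
  rw [e1, e2, hv]
  constructor <;> linarith

lemma stdFace_orbit_zero {n : ℕ} (hn : 2 ≤ n) {K : Set ℕ} {f : Face n} (hf : f ∈ orbit n K)
    (h0 : f (ra n 0) (rb n 0) = 0) (h1 : f (ra n 1) (rb n 1) = 0) : 0 ∈ K ∧ 1 ∈ K := by
  obtain ⟨w, hw, rfl⟩ := mem_orbit.1 hf
  have hv := isOdd_stdVec n K
  have e1 : ra n 0 = neg (ra n 1) := by simp [ra, pt_neg]
  have e2 : rb n 0 = rb n 1 := by simp [rb, one_add_one_eq_two]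
  have hr := isRoot_simple hn (show 1 < n by omega)
  have hr0 := isRoot_simple hn (show 0 < n by omega)
  rw [stdFace, act_sgn hn hw, sgn, if_pos hr0, sign_eq_zero_iff] at h0
  rw [stdFace, act_sgn hn hw, sgn, if_pos hr, sign_eq_zero_iff] at h1
  simp only [Function.comp_apply] at h0 h1
  rw [e1, e2, map_neg_of_mem hn (inv_mem hw), hv] at h0
  have := simple_zero_of_dominant hn hv (dominant_stdVec hn K)
    ((isRoot_map hn (inv_mem hw) _ _).2 hr) (by linarith) (by linarith)
  exact ⟨(stdVec_eq_iff hn (by omega) K).1 this.1, (stdVec_eq_iff hn (by omega) K).1 this.2⟩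

lemma fmul_eq_zero {n : ℕ} {f g : Face n} {a b : Dom n} :
    fmul f g a b = 0 ↔ f a b = 0 ∧ g a b = 0 := by
  unfold fmul; split_ifs with h <;> simp [h]

lemma XX_mul_XX_mem {n : ℕ} (hn : 2 ≤ n) {J K : Set ℕ} (hJ : J ⊆ Set.Iio n)
    (hK : K ⊆ Set.Iio n) :
    XX n J * XX n K ∈ Submodule.span ℚ {a | ∃ L ⊆ Set.Iio n,
      (0 ∈ L ∧ 1 ∈ L → (0 ∈ J ∧ 1 ∈ J) ∧ (0 ∈ K ∧ 1 ∈ K)) ∧ a = XX n L} := by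
  rw [XX_mul_XX hn hJ hK]
  set T := orbit n J ×ˢ orbit n K with hT
  have hface : ∀ p ∈ T, IsFace (fmul p.2 p.1) := fun p hp =>
    (isFace_of_mem_orbit hn (Finset.mem_product.1 hp).2).fmul
      (isFace_of_mem_orbit hn (Finset.mem_product.1 hp).1)
  rw [← Finset.sum_fiberwise_of_maps_to (t := (Finset.range n).powerset)
    (g := fun p => faceType (fmul p.2 p.1))
    (fun p _ => Finset.mem_powerset.2 (Finset.filter_subset _ _))]
  refine Submodule.sum_mem _ fun L hL => ?_
  have hL' := Finset.mem_powerset.1 hL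
  have hLs : (L : Set ℕ) ⊆ Set.Iio n := fun s hs => Finset.mem_range.1 (hL' hs)
  set m : Face n → ℕ := fun f => (T.filter fun p => fmul p.2 p.1 = f).card with hm
  have hinv : ∀ f ∈ orbit n (L : Set ℕ), m f = m (stdFace n L) := by
    intro f hf
    obtain ⟨w, hw, rfl⟩ := mem_orbit.1 hf
    symm
    refine Finset.card_bij' (fun p _ => (act w p.1, act w p.2))
      (fun p _ => (act w⁻¹ p.1, act w⁻¹ p.2)) ?_ ?_ ?_ ?_
    · intro p hp
      simp only [hT, Finset.mem_filter, Finset.mem_product] at hp ⊢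
      exact ⟨⟨act_mem_orbit hp.1.1 hw, act_mem_orbit hp.1.2 hw⟩, by rw [← act_fmul, hp.2]⟩
    · intro p hp
      simp only [hT, Finset.mem_filter, Finset.mem_product] at hp ⊢
      exact ⟨⟨act_mem_orbit hp.1.1 (inv_mem hw), act_mem_orbit hp.1.2 (inv_mem hw)⟩, by
        rw [← act_fmul, hp.2, act_inv_act]⟩
    · intro p _; simp only [act_inv_act]
    · intro p _; simp only [act_act_inv]
  have hsum : ∑ p ∈ T with faceType (fmul p.2 p.1) = L,
      MonoidAlgebra.of ℚ (Equiv.Perm (Dom n)) (proj (fmul p.2 p.1)) =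
        (m (stdFace n L) : ℚ) • XX n L := by
    rw [← Finset.sum_fiberwise_of_maps_to (t := orbit n (L : Set ℕ))
      (g := fun p : Face n × Face n => fmul p.2 p.1), XX_eq hn hLs, Finset.smul_sum]
    · refine Finset.sum_congr rfl fun f hf => ?_
      have hfil : ((T.filter fun p => faceType (fmul p.2 p.1) = L).filter
          fun p => fmul p.2 p.1 = f) = T.filter fun p => fmul p.2 p.1 = f := by
        rw [Finset.filter_filter]
        refine Finset.filter_congr fun p hp => ⟨fun h => h.2, fun h => ⟨?_, h⟩⟩
        exact (mem_orbit_iff_faceType hn (hface p hp) hL').1 (h ▸ hf)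
      rw [hfil, ← hinv f hf, Finset.sum_congr rfl (g := fun _ =>
        MonoidAlgebra.of ℚ (Equiv.Perm (Dom n)) (proj f))
        (fun p hp => by rw [(Finset.mem_filter.1 hp).2]), Finset.sum_const, Nat.cast_smul_eq_nsmul]
    · intro p hp
      have hp' := Finset.mem_filter.1 hp
      exact (mem_orbit_iff_faceType hn (hface p hp'.1) hL').2 hp'.2
  rw [hsum]
  by_cases h0 : m (stdFace n L) = 0
  · rw [h0, Nat.cast_zero, zero_smul]; exact zero_mem _
  · refine Submodule.smul_mem _ _ (Submodule.subset_span ⟨L, hLs, fun ⟨hL0, hL1⟩ => ?_, rfl⟩)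
    obtain ⟨p, hp⟩ := Finset.card_ne_zero.1 h0
    simp only [hT, Finset.mem_filter, Finset.mem_product] at hp
    obtain ⟨⟨hp1, hp2⟩, he⟩ := hp
    have z0 := (stdFace_simple hn (show 0 < n by omega) (L : Set ℕ)).2 hL0
    have z1 := (stdFace_simple hn (show 1 < n by omega) (L : Set ℕ)).2 hL1
    rw [← he, fmul_eq_zero] at z0 z1
    exact ⟨stdFace_orbit_zero hn hp1 z0.2 z1.2, stdFace_orbit_zero hn hp2 z0.1 z1.1⟩

/-! ### Compositions and the ideal -/

lemma exists_composition (n : ℕ) (A : Set ℕ) (hA : A ⊆ Set.Ioo 0 (n + 1)) :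
    ∃ (h : ℕ) (t : List ℕ), 0 < h ∧ (∀ x ∈ t, 0 < x) ∧ h + t.sum = n + 1 ∧
      {s | ∃ j, 1 ≤ j ∧ j < (h :: t).length ∧ s = psum (h :: t) j} = A ∧
      (0 < n → (h = 1 ↔ 1 ∈ A)) := by
  induction n generalizing A with
  | zero =>
    refine ⟨1, [], by simp, by simp, by simp, ?_, by simp⟩
    ext s
    simp only [Set.mem_ofPred_eq, List.length_singleton]
    constructor
    · rintro ⟨j, h1, h2, -⟩; omega
    · intro hs; have := hA hs; simp at this; omega
  | succ n ih =>
    obtain ⟨h, t, hh, ht, hsum, hset, -⟩ := ih {a | 0 < a ∧ a + 1 ∈ A} fun a ha => by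
      have := hA ha.2
      simp only [Set.mem_Ioo] at this ⊢
      exact ⟨ha.1, by omega⟩
    have hmem : ∀ s, 0 < s → (s + 1 ∈ A ↔ ∃ j, j + 1 < (h :: t).length ∧
        s = h + (t.take j).sum) := by
      intro s hs
      have h1 : s + 1 ∈ A ↔ s ∈ {a | 0 < a ∧ a + 1 ∈ A} := ⟨fun h => ⟨hs, h⟩, fun h => h.2⟩
      rw [h1, ← hset]
      constructor
      · rintro ⟨j, hj1, hj2, rfl⟩
        obtain ⟨i, rfl⟩ := Nat.exists_eq_add_of_le' hj1
        exact ⟨i, hj2, by simp [psum]⟩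
      · rintro ⟨i, hi, rfl⟩
        exact ⟨i + 1, by omega, hi, by simp [psum]⟩
    by_cases h1 : 1 ∈ A
    · refine ⟨1, h :: t, one_pos, by simpa using ⟨hh, ht⟩, by simp; omega, ?_, by simp [h1]⟩
      ext s
      constructor
      · rintro ⟨j, hj1, hj2, rfl⟩
        rcases j with _ | _ | j
        · omega
        · simpa [psum] using h1
        · have := (hmem (h + (t.take j).sum) (by omega)).2 ⟨j, by simpa using hj2, rfl⟩
          simpa [psum, add_comm, add_left_comm] using this
      · intro hs
        have hs0 := (hA hs).1
        obtain ⟨a, rfl⟩ := Nat.exists_eq_add_of_le' (show 1 ≤ s from hs0)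
        rcases Nat.eq_zero_or_pos a with rfl | ha
        · exact ⟨1, le_rfl, by simp, by simp [psum]⟩
        · obtain ⟨j, hj, rfl⟩ := (hmem a ha).1 hs
          exact ⟨j + 2, by omega, by simpa using hj, by simp [psum]; omega⟩
    · refine ⟨h + 1, t, by omega, ht, by omega, ?_, fun _ => by simp [h1]; omega⟩
      ext s
      constructor
      · rintro ⟨j, hj1, hj2, rfl⟩
        obtain ⟨j, rfl⟩ := Nat.exists_eq_add_of_le' hj1
        have := (hmem (h + (t.take j).sum) (by omega)).2 ⟨j, by simpa using hj2, rfl⟩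
        simpa [psum, add_right_comm] using this
      · intro hs
        have hs0 := (hA hs).1
        obtain ⟨a, rfl⟩ := Nat.exists_eq_add_of_le' (show 1 ≤ s from hs0)
        rcases Nat.eq_zero_or_pos a with rfl | ha
        · exact absurd hs h1
        · obtain ⟨j, hj, rfl⟩ := (hmem a ha).1 hs
          exact ⟨j + 1, by omega, by simpa using hj, by simp [psum]; omega⟩

lemma XX_mem_idealGens {n : ℕ} (hn : 2 ≤ n) {K : Set ℕ} (hK : K ⊆ Set.Iio n)
    (h : ¬(0 ∈ K ∧ 1 ∈ K)) : XX n K ∈ idealGens n := by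
  have hcompl : ∀ J : Set ℕ, J = Set.Iio n \ K → K = Set.Iio n \ J := by
    rintro J rfl
    rw [Set.sdiff_sdiff_cancel_left hK]
  obtain ⟨m, rfl⟩ : ∃ m, n = m + 1 := ⟨n - 1, by omega⟩
  have hm : 0 < m := by omega
  by_cases h0 : 0 ∈ K
  · have h1 : 1 ∉ K := fun h1 => h ⟨h0, h1⟩
    obtain ⟨a, t, ha, ht, hsum, hset, hone⟩ := exists_composition m
      ((Set.Iio (m + 1) \ K) \ {1}) fun s hs =>
        ⟨Nat.pos_of_ne_zero fun e => hs.1.2 (e ▸ h0), hs.1.1⟩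
    have ha1 : a ≠ 1 := by simp [hone hm]
    refine ⟨.prime, a :: t, by simp, ⟨by simpa using ⟨ha, ht⟩, by simpa using hsum, ?_⟩, ?_⟩
    · simp only [List.headD_cons]; omega
    · rw [B, ← hcompl]
      rw [JofC, hset, Set.union_sdiff_self, Set.union_eq_self_of_subset_left]
      simpa using ⟨hm, h1⟩
  · obtain ⟨a, t, ha, ht, hsum, hset, hone⟩ := exists_composition m
      ((Set.Iio (m + 1) \ K) \ {0}) fun s hs => ⟨Nat.pos_of_ne_zero hs.2, hs.1.1⟩
    have hJ : {0} ∪ (Set.Iio (m + 1) \ K) \ {0} = Set.Iio (m + 1) \ K := by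
      rw [Set.union_sdiff_self, Set.union_eq_self_of_subset_left]
      simpa using h0
    by_cases h1 : a = 1
    · refine ⟨.one, a :: t, by simp, ⟨by simpa using ⟨ha, ht⟩, by simpa using hsum, h1⟩, ?_⟩
      rw [B, ← hcompl]
      rw [JofC, hset, hJ]
    · refine ⟨.reg, a :: t, by simp, ⟨by simpa using ⟨ha, ht⟩, by simpa using hsum, ?_⟩, ?_⟩
      · simp only [List.headD_cons]; omega
      · rw [B, ← hcompl]
        rw [JofC, hset, hJ]

lemma idealGens_eq {n : ℕ} (hn : 2 ≤ n) :
    idealGens n = {a | ∃ K ⊆ Set.Iio n, ¬(0 ∈ K ∧ 1 ∈ K) ∧ a = XX n K} := by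
  ext a
  constructor
  · rintro ⟨k, q, hk, -, rfl⟩
    refine ⟨_, Set.sdiff_subset, ?_, rfl⟩
    rcases k <;> simp_all [JofC]
  · rintro ⟨K, hK, h, rfl⟩
    exact XX_mem_idealGens hn hK h

lemma SigmaD_mul_IdealI_le {n : ℕ} (hn : 2 ≤ n) : SigmaD n * IdealI n ≤ IdealI n := by
  rw [SigmaD, IdealI, idealGens_eq hn, Submodule.span_mul_span, Submodule.span_le]
  rintro _ ⟨_, ⟨J, hJ, rfl⟩, _, ⟨K, hK, h, rfl⟩, rfl⟩
  refine Submodule.span_mono ?_ (XX_mul_XX_mem hn hJ hK)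
  rintro _ ⟨L, hL, hLJ, rfl⟩
  exact ⟨L, hL, fun h' => h (hLJ h').2, rfl⟩

lemma IdealI_mul_SigmaD_le {n : ℕ} (hn : 2 ≤ n) : IdealI n * SigmaD n ≤ IdealI n := by
  rw [SigmaD, IdealI, idealGens_eq hn, Submodule.span_mul_span, Submodule.span_le]
  rintro _ ⟨_, ⟨J, hJ, h, rfl⟩, _, ⟨K, hK, rfl⟩, rfl⟩
  refine Submodule.span_mono ?_ (XX_mul_XX_mem hn hJ hK)
  rintro _ ⟨L, hL, hLJ, rfl⟩
  exact ⟨L, hL, fun h' => h (hLJ h').1, rfl⟩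

/-- The `ℚ`-subspace `𝓘` of `ΣD_n` spanned by `{B_q : q ∈ C_1 ∪ C_n ∪ C_n'}` is a
two-sided ideal of the descent algebra `ΣD_n`. -/
theorem IdealI_is_two_sided_ideal (n : ℕ) (hn : 2 ≤ n) :
    IdealI n ≤ SigmaD n ∧
      ∀ x ∈ SigmaD n, ∀ y ∈ IdealI n, x * y ∈ IdealI n ∧ y * x ∈ IdealI n := by
  refine ⟨?_, fun x hx y hy => ⟨SigmaD_mul_IdealI_le hn (Submodule.mul_mem_mul hx hy),
    IdealI_mul_SigmaD_le hn (Submodule.mul_mem_mul hy hx)⟩⟩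
  rw [IdealI, idealGens_eq hn]
  refine Submodule.span_mono ?_
  rintro _ ⟨K, hK, -, rfl⟩
  exact ⟨K, hK, rfl⟩

end DescentD
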